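/- arXiv:2605.11841 — 3 statements merged into one kernel-verified Lean document; each statement's English description precedes it below -/
import Mathlib

section
/- Let H be a real Hilbert space with a Hilbert (orthonormal) basis (e_i)_{i≥1}. Let (λ_i)_{i≥1} be a nonincreasing sequence of positive reals with λ_i ≤ C · i^{-β} for all i, where C > 0 and β > 0, and let α ∈ (0,1], A > 0, R > 0, and M ≥ 1 a natural number. Let T : H → H be a bounded linear operator with operator norm ‖T‖ ≤ 1 which satisfies the low-frequency approximation property: for every square-summable sequence (h_i)_{i=1}^M, ‖(I − T)(Σ_{i=1}^M λ_i^α h_i e_i)‖ ≤ A · M^{-αβ} · (Σ_{i=1}^M h_i²)^{1/2}. Then for every f = Σ_{i≥1} λ_i^α g_i e_i with Σ_{i≥1} g_i² ≤ R², one has ‖f − T f‖ ≤ (A + 2·C^α) · M^{-αβ} · R. -/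
/-- Abstract bias lemma. H a real Hilbert space with Hilbert basis (e_i),
λ nonincreasing positive with λ_i ≤ C·i^{-β} (indices shifted so that `i : ℕ`
represents rank i+1), α ∈ (0,1], T a bounded operator with ‖T‖ ≤ 1 satisfying the
low-frequency approximation property on the span of the first M basis directions.
Then for f = Σ λ_i^α g_i e_i with Σ g_i² ≤ R²: ‖f − T f‖ ≤ (A + 2C^α)·M^{-αβ}·R. -/
theorem abstract_bias_bound
    {H : Type*} [NormedAddCommGroup H] [InnerProductSpace ℝ H] [CompleteSpace H]
    (e : HilbertBasis ℕ ℝ H)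
    (lam : ℕ → ℝ) (C β α A R : ℝ) (M : ℕ)
    (hC : 0 < C) (hβ : 0 < β) (hα0 : 0 < α) (hα1 : α ≤ 1)
    (hA : 0 < A) (hR : 0 < R) (hM : 1 ≤ M)
    (hpos : ∀ i, 0 < lam i)
    (hmono : ∀ i j, i ≤ j → lam j ≤ lam i)
    (hdecay : ∀ i : ℕ, lam i ≤ C * ((i : ℝ) + 1) ^ (-β))
    (T : H →L[ℝ] H) (hT : ‖T‖ ≤ 1)
    (hlow : ∀ h : ℕ → ℝ,
      ‖(∑ i ∈ Finset.range M, (lam i ^ α * h i) • e i)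
          - T (∑ i ∈ Finset.range M, (lam i ^ α * h i) • e i)‖
        ≤ A * (M : ℝ) ^ (-(α * β)) * Real.sqrt (∑ i ∈ Finset.range M, h i ^ 2))
    (g : ℕ → ℝ) (hg_sum : Summable fun i => g i ^ 2) (hg : ∑' i, g i ^ 2 ≤ R ^ 2)
    (f : H) (hf : HasSum (fun i => (lam i ^ α * g i) • e i) f) :
    ‖f - T f‖ ≤ (A + 2 * C ^ α) * (M : ℝ) ^ (-(α * β)) * R := by
  set D : ℝ := C ^ α * (M : ℝ) ^ (-(α * β)) with hD
  have hMpos : (0 : ℝ) < M := by exact_mod_cast hM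
  have hD0 : 0 ≤ D := by positivity
  have hlamD : ∀ i, M ≤ i → lam i ^ α ≤ D := by
    intro i hi
    have h1 : lam i ≤ C * (M : ℝ) ^ (-β) := by
      refine (hdecay i).trans ?_
      have h2 : (M : ℝ) ≤ (i : ℝ) + 1 := by
        have : (M : ℝ) ≤ i := by exact_mod_cast hi
        linarith
      exact mul_le_mul_of_nonneg_left
        (Real.rpow_le_rpow_of_nonpos hMpos h2 (by linarith)) hC.le
    calc lam i ^ α ≤ (C * (M : ℝ) ^ (-β)) ^ α :=
          Real.rpow_le_rpow (hpos i).le h1 hα0.le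
      _ = D := by
          rw [Real.mul_rpow hC.le (by positivity), ← Real.rpow_mul hMpos.le, hD]
          congr 2
          ring
  have hpart : ∀ s : Finset ℕ, ∑ i ∈ s, g i ^ 2 ≤ R ^ 2 := fun s =>
    (hg_sum.sum_le_tsum s (fun i _ => sq_nonneg _)).trans hg
  set S : ℕ → H := fun N => ∑ i ∈ Finset.range N, (lam i ^ α * g i) • e i with hS
  have htail : ∀ N, M ≤ N → ‖S N - S M‖ ≤ D * R := by
    intro N hN
    have h1 : S N - S M = ∑ i ∈ Finset.Ico M N, (lam i ^ α * g i) • e i := by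
      rw [Finset.sum_Ico_eq_sub _ hN]
    have h2 : ‖S N - S M‖ ^ 2 = ∑ i ∈ Finset.Ico M N, (lam i ^ α * g i) ^ 2 := by
      rw [h1, ← real_inner_self_eq_norm_sq, e.orthonormal.inner_sum]
      refine Finset.sum_congr rfl fun i _ => ?_
      simp [sq]
    refine abs_le_of_sq_le_sq' ?_ (by positivity) |>.2
    rw [h2, mul_pow]
    calc ∑ i ∈ Finset.Ico M N, (lam i ^ α * g i) ^ 2
        ≤ ∑ i ∈ Finset.Ico M N, D ^ 2 * g i ^ 2 := by
          refine Finset.sum_le_sum fun i hi => ?_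
          rw [mul_pow]
          have h3 := hlamD i (Finset.mem_Ico.1 hi).1
          have h4 : 0 ≤ lam i ^ α := Real.rpow_nonneg (hpos i).le _
          gcongr
      _ = D ^ 2 * ∑ i ∈ Finset.Ico M N, g i ^ 2 := by rw [Finset.mul_sum]
      _ ≤ D ^ 2 * R ^ 2 := mul_le_mul_of_nonneg_left (hpart _) (sq_nonneg _)
  have hr : ‖f - S M‖ ≤ D * R := by
    have ht : Filter.Tendsto (fun N => ‖S N - S M‖) Filter.atTop (nhds ‖f - S M‖) :=
      (hf.tendsto_sum_nat.sub_const (S M)).norm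
    exact le_of_tendsto ht (Filter.eventually_atTop.2 ⟨M, htail⟩)
  have hTr : ‖T (f - S M)‖ ≤ ‖f - S M‖ := by
    simpa using T.le_of_opNorm_le hT (f - S M)
  have hl : ‖S M - T (S M)‖ ≤ A * (M : ℝ) ^ (-(α * β)) * R := by
    refine (hlow g).trans (mul_le_mul_of_nonneg_left ?_ (by positivity))
    exact Real.sqrt_le_iff.2 ⟨hR.le, hpart _⟩
  have hsplit : f - T f = (S M - T (S M)) + ((f - S M) - T (f - S M)) := by
    rw [map_sub]; abel
  calc ‖f - T f‖ ≤ ‖S M - T (S M)‖ + (‖f - S M‖ + ‖T (f - S M)‖) := by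
        rw [hsplit]
        exact (norm_add_le _ _).trans (by gcongr; exact norm_sub_le _ _)
    _ ≤ A * (M : ℝ) ^ (-(α * β)) * R + (D * R + D * R) := by linarith
    _ = (A + 2 * C ^ α) * (M : ℝ) ^ (-(α * β)) * R := by rw [hD]; ring
end

section
/- Let n ≥ 1 be a natural number and p ∈ (0,1] a real number with n·p ≥ 1, and let Z be a random variable with the Binomial(n, p) distribution. Then E[ (if Z ≥ 1 then 1/Z else 0) ] ≤ 2/(n·p). -/
open MeasureTheory

/-- If Z ~ Binomial(n, p) with n ≥ 1, p ∈ (0,1] and n·p ≥ 1, then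
E[ 1{Z ≥ 1} / Z ] ≤ 2/(n·p). -/
theorem inverse_binomial_moment_bound
    (n : ℕ) (hn : 1 ≤ n) (p : ℝ) (hp0 : 0 < p) (hp1 : p ≤ 1)
    (hnp : 1 ≤ (n : ℝ) * p)
    {Ω : Type*} [MeasurableSpace Ω] (P : Measure Ω) [IsProbabilityMeasure P]
    (Z : Ω → ℕ) (hZmeas : Measurable Z)
    (hZlaw : ∀ k : ℕ,
      P {ω | Z ω = k} = ENNReal.ofReal ((n.choose k : ℝ) * p ^ k * (1 - p) ^ (n - k))) :
    ∫ ω, (if 1 ≤ Z ω then 1 / (Z ω : ℝ) else 0) ∂P ≤ 2 / ((n : ℝ) * p) := by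
  have hq : 0 ≤ 1 - p := by linarith
  have hn' : (0 : ℝ) < n := by exact_mod_cast hn
  set f : ℕ → ℝ := fun k => if 1 ≤ k then 1 / (k : ℝ) else 0 with hf
  have hfb : ∀ k, 0 ≤ f k ∧ f k ≤ 2 / ((k : ℝ) + 1) := by
    intro k
    simp only [hf]
    split_ifs with h
    · have h1 : (1 : ℝ) ≤ k := by exact_mod_cast h
      refine ⟨by positivity, ?_⟩
      rw [div_le_div_iff₀ (by linarith) (by linarith)]
      linarith
    · exact ⟨le_rfl, by positivity⟩
  have hprob : IsProbabilityMeasure (P.map Z) :=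
    Measure.isProbabilityMeasure_map hZmeas.aemeasurable
  have hint : Integrable f (P.map Z) := by
    refine Integrable.of_bound (C := 2) (measurable_of_countable f).aestronglyMeasurable
      (Filter.Eventually.of_forall fun k => ?_)
    rw [Real.norm_of_nonneg (hfb k).1]
    refine (hfb k).2.trans (div_le_self (by norm_num) ?_)
    have : (0 : ℝ) ≤ k := k.cast_nonneg
    linarith
  have hlaw : ∀ k, (P.map Z).real {k} = (n.choose k : ℝ) * p ^ k * (1 - p) ^ (n - k) := by
    intro k
    rw [measureReal_def, Measure.map_apply hZmeas (measurableSet_singleton k)]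
    have : Z ⁻¹' {k} = {ω | Z ω = k} := rfl
    rw [this, hZlaw, ENNReal.toReal_ofReal (by positivity)]
  have h1 : ∫ ω, (if 1 ≤ Z ω then 1 / (Z ω : ℝ) else 0) ∂P
      = ∑ k ∈ Finset.range (n + 1), (n.choose k : ℝ) * p ^ k * (1 - p) ^ (n - k) * f k := by
    have : ∫ ω, f (Z ω) ∂P = ∫ k, f k ∂(P.map Z) :=
      (integral_map hZmeas.aemeasurable
        (measurable_of_countable f).aestronglyMeasurable).symm
    refine this.trans ?_
    rw [integral_countable' hint, tsum_eq_sum (s := Finset.range (n + 1))]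
    · simp only [hlaw, smul_eq_mul]
    · intro k hk
      have : n < k := by simpa using hk
      simp [hlaw, Nat.choose_eq_zero_of_lt this]
  have h2 : ∑ k ∈ Finset.range (n + 1),
      ((n + 1).choose (k + 1) : ℝ) * p ^ (k + 1) * (1 - p) ^ (n - k) ≤ 1 := by
    have h := add_pow p (1 - p) (n + 1)
    rw [Finset.sum_range_succ'] at h
    have e : ∀ k, n + 1 - (k + 1) = n - k := fun k => by omega
    simp only [e] at h
    have h0 : 0 ≤ (1 - p) ^ (n + 1) := by positivity
    simp at h
    calc _ = ∑ k ∈ Finset.range (n + 1),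
          p ^ (k + 1) * (1 - p) ^ (n - k) * ((n + 1).choose (k + 1) : ℝ) :=
          Finset.sum_congr rfl fun k _ => by ring
      _ ≤ 1 := by linarith
  rw [h1]
  calc _ ≤ ∑ k ∈ Finset.range (n + 1), 2 / (((n : ℝ) + 1) * p) *
        (((n + 1).choose (k + 1) : ℝ) * p ^ (k + 1) * (1 - p) ^ (n - k)) := by
        refine Finset.sum_le_sum fun k _ => ?_
        refine (mul_le_mul_of_nonneg_left (hfb k).2 (by positivity)).trans (le_of_eq ?_)
        have hc : ((n : ℝ) + 1) * n.choose k = (n + 1).choose (k + 1) * ((k : ℝ) + 1) := by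
          exact_mod_cast Nat.add_one_mul_choose_eq n k
        have hk : (k : ℝ) + 1 ≠ 0 := by positivity
        field_simp
        linear_combination (p * p ^ k * (1 - p) ^ (n - k)) * hc
    _ ≤ 2 / (((n : ℝ) + 1) * p) * 1 := by
        rw [← Finset.mul_sum]
        exact mul_le_mul_of_nonneg_left h2 (by positivity)
    _ ≤ 2 / ((n : ℝ) * p) := by
        rw [mul_one]
        gcongr
        linarith
end

section
/- Let (X, 𝒜, μ) be a probability space and x_1, …, x_N ∈ X with N ≥ 1. For each b ∈ {1,…,B} (B ≥ 1), let {A^b_ℓ}_{ℓ ∈ L_b} be a finite measurable partition of X such that every cell contains at least one of the points x_1,…,x_N, and let N^b_ℓ = #{ i : x_i ∈ A^b_ℓ } ≥ 1. For x ∈ X define n_b(x) = N^b_ℓ for the unique cell A^b_ℓ containing x, and w^b_i(x) = 1/n_b(x) if x_i lies in the same cell of partition b as x, and 0 otherwise. Then ∫ Σ_{i=1}^N ( (1/B) Σ_{b=1}^B w^b_i(x) )² dμ(x) ≤ (1/B) Σ_{b=1}^B Σ_{ℓ ∈ L_b} μ(A^b_ℓ) / N^b_ℓ. -/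
open scoped Classical

open MeasureTheory

/-- Integrated squared forest-weight bound. For B finite measurable
partitions of a probability space, each cell containing at least one of the N data
points, the in-leaf uniform weights w^b_i(x) = 1/n_b(x) (for x_i in the cell of x,
else 0; expressed below as a sum over cells, which is well-defined by disjointness)
satisfy ∫ Σ_i ((1/B) Σ_b w^b_i(x))² dμ(x) ≤ (1/B) Σ_b Σ_ℓ μ(A^b_ℓ)/N^b_ℓ. -/
theorem integrated_squared_weight_bound
    {X : Type*} [MeasurableSpace X] (μ : Measure X) [IsProbabilityMeasure μ]
    (N B : ℕ) (hN : 1 ≤ N) (hB : 1 ≤ B)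
    (x : Fin N → X)
    (L : Fin B → Type) [∀ b, Fintype (L b)]
    (A : (b : Fin B) → L b → Set X)
    (hAmeas : ∀ b ℓ, MeasurableSet (A b ℓ))
    (hAdisj : ∀ b, ∀ ℓ ℓ' : L b, ℓ ≠ ℓ' → Disjoint (A b ℓ) (A b ℓ'))
    (hAcover : ∀ b, (⋃ ℓ, A b ℓ) = Set.univ)
    (Nc : (b : Fin B) → L b → ℕ)
    (hNc : ∀ b ℓ, Nc b ℓ = (Finset.univ.filter fun i => x i ∈ A b ℓ).card)
    (hNc_pos : ∀ b ℓ, 1 ≤ Nc b ℓ)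
    (w : Fin B → Fin N → X → ℝ)
    (hw : ∀ b i y, w b i y =
      ∑ ℓ, if y ∈ A b ℓ ∧ x i ∈ A b ℓ then 1 / (Nc b ℓ : ℝ) else 0) :
    ∫ y, (∑ i, ((B : ℝ)⁻¹ * ∑ b, w b i y) ^ 2) ∂μ
      ≤ (B : ℝ)⁻¹ * ∑ b, ∑ ℓ, (μ (A b ℓ)).toReal / (Nc b ℓ : ℝ) := by
  have key : ∀ b y, ∑ i, (w b i y) ^ 2
      = ∑ ℓ, (A b ℓ).indicator (fun _ => 1 / (Nc b ℓ : ℝ)) y := by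
    intro b y
    have hy : y ∈ ⋃ ℓ, A b ℓ := by rw [hAcover b]; trivial
    obtain ⟨k, hk⟩ := Set.mem_iUnion.1 hy
    have hne : ∀ ℓ, ℓ ≠ k → y ∉ A b ℓ := fun ℓ h hm =>
      Set.disjoint_left.1 (hAdisj b ℓ k h) hm hk
    have h1 : ∀ i, w b i y = if x i ∈ A b k then 1 / (Nc b k : ℝ) else 0 := by
      intro i
      rw [hw, Finset.sum_eq_single k]
      · simp [hk]
      · intro ℓ _ h
        simp [hne ℓ h]
      · simp
    have h2 : ∑ ℓ, (A b ℓ).indicator (fun _ => 1 / (Nc b ℓ : ℝ)) y = 1 / (Nc b k : ℝ) := by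
      rw [Finset.sum_eq_single k]
      · simp [hk]
      · intro ℓ _ h
        simp [hne ℓ h]
      · simp
    have h3 : (Nc b k : ℝ) ≠ 0 := by
      have := hNc_pos b k
      positivity
    have h4 : ∀ i, (w b i y) ^ 2 = if x i ∈ A b k then (1 / (Nc b k : ℝ)) ^ 2 else 0 := by
      intro i
      rw [h1]
      split_ifs <;> simp
    rw [h2, Finset.sum_congr rfl fun i _ => h4 i, ← Finset.sum_filter, Finset.sum_const,
      ← hNc b k, nsmul_eq_mul]
    field_simp
  have hB0 : (0 : ℝ) < B := by exact_mod_cast hB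
  have pt : ∀ y, (∑ i, ((B : ℝ)⁻¹ * ∑ b, w b i y) ^ 2)
      ≤ (B : ℝ)⁻¹ * ∑ b, ∑ ℓ, (A b ℓ).indicator (fun _ => 1 / (Nc b ℓ : ℝ)) y := by
    intro y
    simp_rw [← key]
    rw [Finset.sum_comm, Finset.mul_sum]
    refine Finset.sum_le_sum fun i _ => ?_
    have h := sq_sum_le_card_mul_sum_sq (s := (Finset.univ : Finset (Fin B)))
      (f := fun b => w b i y)
    simp only [Finset.card_univ, Fintype.card_fin] at h
    calc ((B : ℝ)⁻¹ * ∑ b, w b i y) ^ 2 = ((B : ℝ)⁻¹) ^ 2 * (∑ b, w b i y) ^ 2 := by ring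
      _ ≤ ((B : ℝ)⁻¹) ^ 2 * (B * ∑ b, (w b i y) ^ 2) := by gcongr
      _ = (B : ℝ)⁻¹ * ∑ b, (w b i y) ^ 2 := by field_simp
  have hint : ∀ b ℓ, Integrable ((A b ℓ).indicator (fun _ => 1 / (Nc b ℓ : ℝ))) μ :=
    fun b ℓ => (integrable_const _).indicator (hAmeas b ℓ)
  have hint2 : ∀ b, Integrable
      (fun y => ∑ ℓ, (A b ℓ).indicator (fun _ => 1 / (Nc b ℓ : ℝ)) y) μ :=
    fun b => integrable_finset_sum _ fun ℓ _ => hint b ℓ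
  refine (integral_mono_of_nonneg (Filter.Eventually.of_forall fun y =>
    Finset.sum_nonneg fun i _ => sq_nonneg _)
    ((integrable_finset_sum _ fun b _ => hint2 b).const_mul _)
    (Filter.Eventually.of_forall pt)).trans (le_of_eq ?_)
  rw [integral_const_mul, integral_finset_sum _ fun b _ => hint2 b]
  congr 1
  refine Finset.sum_congr rfl fun b _ => ?_
  rw [integral_finset_sum _ fun ℓ _ => hint b ℓ]
  refine Finset.sum_congr rfl fun ℓ _ => ?_
  rw [integral_indicator_const _ (hAmeas b ℓ), smul_eq_mul, Measure.real]
  ring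
end
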